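/- (Gagliardo–Nirenberg inequality for Bessel kernels, bilinear form.) Let m,n ≥ 1, let 0 < α_k < n for k = 1,…,m, set α = Σ α_k, assume 0 < mn − α < n, and let 2 ≤ q ≤ 2n/(mn − α) with p = q/(q−1). Then there exists a finite constant C such that for every nonnegative measurable function h on ℝ^n, ∫_{ℝ^n} ∫_{ℝ^n} h(x) · Π_{k=1}^m G_{α_k}(x − w) · h(w) dx dw ≤ C · (∫_{ℝ^n} h(x)^p dx)^{2/p}. -/

import Mathlib

open MeasureTheory Real
open scoped ENNReal

noncomputable section

/-- The Bessel kernel `G_a` on `ℝ^n`: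
`G_a(x) = (4π)^{−a/2} Γ(a/2)^{−1} ∫_0^∞ e^{−π|x|²/δ} e^{−δ/(4π)} δ^{(a−n)/2−1} dδ`. -/
def besselG (n : ℕ) (a : ℝ) (x : EuclideanSpace ℝ (Fin n)) : ℝ :=
  (4 * Real.pi) ^ (-(a / 2)) * (Real.Gamma (a / 2))⁻¹ *
    ∫ δ in Set.Ioi (0 : ℝ),
      Real.exp (-(Real.pi * ‖x‖ ^ 2) / δ) * Real.exp (-δ / (4 * Real.pi)) *
        δ ^ ((a - (n : ℝ)) / 2 - 1)

/-- The Gamma integral after the substitution `t ↦ t⁻¹`. -/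
lemma integral_exp_neg_div_mul_rpow {b σ : ℝ} (hb : 0 < b) (hσ : 0 < σ) :
    ∫ t in Set.Ioi (0 : ℝ), exp (-b / t) * t ^ (-σ - 1) = (1 / b) ^ σ * Gamma σ := by
  rw [← integral_rpow_mul_exp_neg_mul_Ioi hσ hb,
    ← integral_comp_rpow_Ioi (fun u => u ^ (σ - 1) * exp (-(b * u))) (neg_ne_zero.2 one_ne_zero)]
  refine setIntegral_congr_fun measurableSet_Ioi fun t ht => ?_
  have ht : 0 < t := ht
  have hpow : t ^ (-σ - 1) = t ^ (-1 - 1 : ℝ) * (t ^ (-1 : ℝ)) ^ (σ - 1) := by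
    rw [← rpow_mul ht.le, ← rpow_add ht]
    ring_nf
  simp only [abs_neg, abs_one, one_mul, smul_eq_mul, hpow, rpow_neg_one, ← div_eq_mul_inv, neg_div]
  ring

lemma integrableOn_exp_neg_div_mul_rpow {b σ : ℝ} (hb : 0 < b) (hσ : 0 < σ) :
    IntegrableOn (fun t : ℝ => exp (-b / t) * t ^ (-σ - 1)) (Set.Ioi 0) := by
  refine .of_integral_ne_zero ?_
  rw [integral_exp_neg_div_mul_rpow hb hσ]
  have := Gamma_pos_of_pos hσ
  positivity

lemma exp_neg_mul_le_mul_rpow_neg {c e t : ℝ} (hc : 0 < c) (he : 0 ≤ e) (ht : 0 < t) :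
    exp (-(c * t)) ≤ (c / (e + 1)) ^ (-e) * t ^ (-e) := by
  have he1 : 0 < e + 1 := by linarith
  rw [← mul_rpow (by positivity) ht.le, rpow_neg (by positivity), exp_neg]
  refine inv_anti₀ (by positivity) ?_
  calc (c / (e + 1) * t) ^ e ≤ exp (c / (e + 1) * t) ^ e := by
        gcongr
        linarith [add_one_le_exp (c / (e + 1) * t)]
    _ = exp (c / (e + 1) * t * e) := (exp_mul _ _).symm
    _ ≤ exp (c * t) := by
        refine exp_le_exp.2 ?_
        rw [div_mul_eq_mul_div, div_mul_eq_mul_div, div_le_iff₀ he1]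
        exact mul_le_mul_of_nonneg_left (by linarith) (by positivity)

/-- The Bessel kernel `G_a` is dominated by every power `‖x‖ ^ (-s)` with `s ≥ n - a`. -/
lemma exists_besselG_le_mul_norm_rpow (n : ℕ) {a s : ℝ} (ha : 0 < a) (hs : 0 < s)
    (has : n - a ≤ s) :
    ∃ C : ℝ, 0 < C ∧ ∀ x : EuclideanSpace ℝ (Fin n), x ≠ 0 → besselG n a x ≤ C * ‖x‖ ^ (-s) := by
  set e : ℝ := (s - (n - a)) / 2 with he
  have he0 : 0 ≤ e := by rw [he]; linarith
  have hΓa := Gamma_pos_of_pos (half_pos ha)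
  have hΓs := Gamma_pos_of_pos (half_pos hs)
  have hc : 0 < 1 / (4 * π) := by positivity
  refine ⟨(4 * π) ^ (-(a / 2)) * (Gamma (a / 2))⁻¹ *
    ((1 / (4 * π) / (e + 1)) ^ (-e) * (π ^ (-(s / 2)) * Gamma (s / 2))), by positivity,
    fun x hx => ?_⟩
  have hx' : 0 < ‖x‖ := norm_pos_iff.2 hx
  have hb : 0 < π * ‖x‖ ^ 2 := by positivity
  have hpow : (1 / (π * ‖x‖ ^ 2)) ^ (s / 2) = π ^ (-(s / 2)) * ‖x‖ ^ (-s) := by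
    rw [one_div, inv_rpow hb.le, ← rpow_neg hb.le, mul_rpow pi_pos.le (by positivity),
      ← rpow_natCast ‖x‖ 2, ← rpow_mul hx'.le]
    congr 2
    push_cast
    ring
  have key : ∫ δ in Set.Ioi (0 : ℝ), exp (-(π * ‖x‖ ^ 2) / δ) * exp (-δ / (4 * π)) *
        δ ^ ((a - (n : ℝ)) / 2 - 1) ≤
      ∫ δ in Set.Ioi (0 : ℝ), (1 / (4 * π) / (e + 1)) ^ (-e) *
        (exp (-(π * ‖x‖ ^ 2) / δ) * δ ^ (-(s / 2) - 1)) := by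
    refine integral_mono_of_nonneg ?_
      ((integrableOn_exp_neg_div_mul_rpow hb (half_pos hs)).const_mul _) ?_
    · filter_upwards [ae_restrict_mem measurableSet_Ioi] with δ hδ
      have hδ : 0 < δ := hδ
      positivity
    · filter_upwards [ae_restrict_mem measurableSet_Ioi] with δ hδ
      have hδ : 0 < δ := hδ
      have hsplit : δ ^ (-(s / 2) - 1) = δ ^ (-e) * δ ^ ((a - (n : ℝ)) / 2 - 1) := by
        rw [← rpow_add hδ, he]
        ring_nf
      have hexp : exp (-δ / (4 * π)) ≤ (1 / (4 * π) / (e + 1)) ^ (-e) * δ ^ (-e) := by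
        convert exp_neg_mul_le_mul_rpow_neg hc he0 hδ using 2
        ring
      calc exp (-(π * ‖x‖ ^ 2) / δ) * exp (-δ / (4 * π)) * δ ^ ((a - (n : ℝ)) / 2 - 1)
          ≤ exp (-(π * ‖x‖ ^ 2) / δ) * ((1 / (4 * π) / (e + 1)) ^ (-e) * δ ^ (-e)) *
              δ ^ ((a - (n : ℝ)) / 2 - 1) := by gcongr
        _ = _ := by rw [hsplit]; ring
  rw [integral_const_mul, integral_exp_neg_div_mul_rpow hb (half_pos hs), hpow] at key
  calc besselG n a x ≤ (4 * π) ^ (-(a / 2)) * (Gamma (a / 2))⁻¹ * _ :=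
        mul_le_mul_of_nonneg_left key (by positivity)
    _ = _ := by ring

/-- A product of Bessel kernels `G_{α k}` is dominated by every power `‖x‖ ^ (-s)` with
`s ≥ ∑ k, (n - α k)`. -/
lemma exists_prod_besselG_le_mul_enorm_rpow {m n : ℕ} {α : Fin m → ℝ}
    (hα : ∀ k, 0 < α k ∧ α k < n) (hlow : 0 < (m : ℝ) * n - ∑ k, α k) {s : ℝ}
    (hs : (m : ℝ) * n - ∑ k, α k ≤ s) :
    ∃ C : ℝ≥0∞, C ≠ ⊤ ∧ ∀ x : EuclideanSpace ℝ (Fin n),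
      ∏ k, ENNReal.ofReal (besselG n (α k) x) ≤ C * ‖x‖ₑ ^ (-s) := by
  set l := (m : ℝ) * n - ∑ k, α k with hl
  have hratio : 1 ≤ s / l := (one_le_div hlow).2 hs
  have hpos : ∀ k, 0 < (n - α k) * (s / l) := fun k =>
    mul_pos (sub_pos.2 (hα k).2) (by linarith)
  have hsum : ∑ k, (n - α k) * (s / l) = s := by
    rw [← Finset.sum_mul]
    simp only [Finset.sum_sub_distrib, Finset.sum_const, Finset.card_univ, Fintype.card_fin,
      nsmul_eq_mul, ← hl]
    field_simp
  choose C hC0 hC using fun k => exists_besselG_le_mul_norm_rpow n (hα k).1 (hpos k)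
    (le_mul_of_one_le_right (sub_pos.2 (hα k).2).le hratio)
  have hCpos : 0 < ∏ k, C k := Finset.prod_pos fun k _ => hC0 k
  refine ⟨ENNReal.ofReal (∏ k, C k), ENNReal.ofReal_ne_top, fun x => ?_⟩
  rcases eq_or_ne x 0 with rfl | hx
  · rw [enorm_zero, ENNReal.zero_rpow_of_neg (by linarith),
      ENNReal.mul_top (ENNReal.ofReal_pos.2 hCpos).ne']
    exact le_top
  have hx' : 0 < ‖x‖ := norm_pos_iff.2 hx
  calc ∏ k, ENNReal.ofReal (besselG n (α k) x)
      ≤ ∏ k, ENNReal.ofReal (C k * ‖x‖ ^ (-((n - α k) * (s / l)))) :=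
        Finset.prod_le_prod' fun k _ => ENNReal.ofReal_le_ofReal (hC k x hx)
    _ = ENNReal.ofReal ((∏ k, C k) * ‖x‖ ^ (-s)) := by
        rw [← ENNReal.ofReal_prod_of_nonneg fun k _ =>
          mul_nonneg (hC0 k).le (rpow_nonneg hx'.le _), Finset.prod_mul_distrib,
          ← rpow_sum_of_pos hx', Finset.sum_neg_distrib, hsum]
    _ = _ := by
        rw [ENNReal.ofReal_mul hCpos.le, ← ENNReal.ofReal_rpow_of_pos hx', ofReal_norm]

section Radial

variable {E : Type*} [NormedAddCommGroup E] [NormedSpace ℝ E] [FiniteDimensional ℝ E]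
  [MeasurableSpace E] [BorelSpace E] (μ : Measure E) [μ.IsAddHaarMeasure]

open Module Metric

lemma lintegral_eq_ofReal_pow_mul_lintegral_comp_smul {R : ℝ} (hR : 0 < R) {F : E → ℝ≥0∞}
    (hF : Measurable F) :
    ∫⁻ y, F y ∂μ = ENNReal.ofReal R ^ (finrank ℝ E : ℝ) * ∫⁻ y, F (R • y) ∂μ := by
  have h := lintegral_map (μ := μ) hF (measurable_const_smul R)
  rw [Measure.map_addHaar_smul μ hR.ne', lintegral_smul_measure, abs_of_pos (by positivity)] at h
  rw [← h, smul_eq_mul, ← mul_assoc, ENNReal.rpow_natCast, ← ENNReal.ofReal_pow hR.le,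
    ← ENNReal.ofReal_mul (by positivity), mul_inv_cancel₀ (by positivity), ENNReal.ofReal_one,
    one_mul]

/-- Scaling of the integral of a power of the norm over a set of radii. -/
lemma setLIntegral_enorm_rpow_eq_mul {R : ℝ} (hR : 0 < R) {S : Set E} (hS : MeasurableSet S)
    (s : ℝ) :
    ∫⁻ y in S, ‖y‖ₑ ^ (-s) ∂μ = ENNReal.ofReal R ^ (finrank ℝ E - s) *
      ∫⁻ y in (R • ·) ⁻¹' S, ‖y‖ₑ ^ (-s) ∂μ := by
  have hmeas : Measurable fun y : E => ‖y‖ₑ ^ (-s) := by fun_prop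
  have hR0 : ENNReal.ofReal R ≠ 0 := (ENNReal.ofReal_pos.2 hR).ne'
  rw [← lintegral_indicator hS, ← lintegral_indicator (measurable_const_smul R hS),
    lintegral_eq_ofReal_pow_mul_lintegral_comp_smul μ hR (hmeas.indicator hS),
    sub_eq_add_neg, ENNReal.rpow_add _ _ hR0 ENNReal.ofReal_ne_top, mul_assoc,
    ← lintegral_const_mul _ (hmeas.indicator (measurable_const_smul R hS))]
  congr 2
  ext y
  by_cases hy : R • y ∈ S
  · rw [Set.indicator_of_mem hy, Set.indicator_of_mem (by exact hy), enorm_smul,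
      Real.enorm_of_nonneg hR.le, ENNReal.mul_rpow_of_ne_top ENNReal.ofReal_ne_top enorm_ne_top]
  · rw [Set.indicator_of_notMem hy, Set.indicator_of_notMem (by exact hy), mul_zero]

lemma setLIntegral_ball_enorm_rpow_ne_top (hd : 1 ≤ finrank ℝ E) {s : ℝ}
    (hsd : s < finrank ℝ E) : ∫⁻ y in ball 0 1, ‖y‖ₑ ^ (-s) ∂μ ≠ ⊤ := by
  have : Nontrivial E := nontrivial_of_finrank_pos (R := ℝ) (by omega)
  have hint : IntegrableOn (fun y : E => ‖y‖ ^ (-s)) (ball 0 1) μ :=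
    integrableOn_ball_of_norm_le_rpow (C := 1) hd hsd
      (ae_of_all _ fun y => by rw [one_mul, norm_of_nonneg (by positivity)])
      (Measurable.aestronglyMeasurable (by fun_prop))
  refine (lt_of_le_of_lt (lintegral_mono_ae ?_) hint.2).ne
  filter_upwards [ae_restrict_of_ae (Measure.ae_ne μ (0 : E))] with y hy
  rw [Real.enorm_of_nonneg (by positivity), ← ENNReal.ofReal_rpow_of_pos (norm_pos_iff.2 hy),
    ofReal_norm]

lemma setLIntegral_compl_ball_enorm_rpow_ne_top {s : ℝ} (hds : finrank ℝ E < s) :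
    ∫⁻ y in (ball 0 1)ᶜ, ‖y‖ₑ ^ (-s) ∂μ ≠ ⊤ := by
  have hs : 0 < s := lt_of_le_of_lt (Nat.cast_nonneg _) hds
  refine (lt_of_le_of_lt (b := ENNReal.ofReal (2 ^ s) *
    ∫⁻ y : E, ENNReal.ofReal ((1 + ‖y‖) ^ (-s)) ∂μ) ?_
    (ENNReal.mul_lt_top ENNReal.ofReal_lt_top (finite_integral_one_add_norm hds))).ne
  rw [← lintegral_const_mul _ (by fun_prop)]
  refine (setLIntegral_mono (by fun_prop) fun y hy => ?_).trans (setLIntegral_le_lintegral _ _)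
  have hy : 1 ≤ ‖y‖ := by simpa using hy
  have hy0 : 0 < ‖y‖ := by linarith
  rw [← ENNReal.ofReal_mul (by positivity), ← ofReal_norm, ENNReal.ofReal_rpow_of_pos hy0]
  refine ENNReal.ofReal_le_ofReal ?_
  have h2 : (2 * ‖y‖) ^ (-s) ≤ (1 + ‖y‖) ^ (-s) :=
    rpow_le_rpow_of_nonpos (by positivity) (by linarith) (by linarith)
  rw [mul_rpow two_pos.le hy0.le, rpow_neg two_pos.le] at h2
  rwa [inv_mul_le_iff₀ (by positivity)] at h2

lemma setLIntegral_ball_enorm_rpow {R : ℝ} (hR : 0 < R) (s : ℝ) :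
    ∫⁻ y in ball 0 R, ‖y‖ₑ ^ (-s) ∂μ = ENNReal.ofReal R ^ (finrank ℝ E - s) *
      ∫⁻ y in ball 0 1, ‖y‖ₑ ^ (-s) ∂μ := by
  have h : (R • · : E → E) ⁻¹' ball 0 R = ball 0 1 := by
    ext y
    simp [norm_smul, abs_of_pos hR, hR]
  rw [setLIntegral_enorm_rpow_eq_mul μ hR measurableSet_ball, h]

lemma setLIntegral_compl_ball_enorm_rpow {R : ℝ} (hR : 0 < R) (s : ℝ) :
    ∫⁻ y in (ball 0 R)ᶜ, ‖y‖ₑ ^ (-s) ∂μ = ENNReal.ofReal R ^ (finrank ℝ E - s) *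
      ∫⁻ y in (ball 0 1)ᶜ, ‖y‖ₑ ^ (-s) ∂μ := by
  have h : (R • · : E → E) ⁻¹' (ball 0 R)ᶜ = (ball 0 1)ᶜ := by
    ext y
    simp [norm_smul, abs_of_pos hR, hR]
  rw [setLIntegral_enorm_rpow_eq_mul μ hR measurableSet_ball.compl, h]

end Radial

section Convolution

variable {E : Type*} [NormedAddCommGroup E] [NormedSpace ℝ E] [FiniteDimensional ℝ E]
  [MeasurableSpace E] [BorelSpace E] (μ : Measure E) [μ.IsAddHaarMeasure]

open Module Metric

/-- For an even kernel, the bilinear form is controlled by its restriction to the pairs `(x, w)`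
with `f w ≤ f x`. -/
lemma lintegral_lintegral_kernel_le_two_mul {f k : E → ℝ≥0∞} (hf : Measurable f)
    (hk : Measurable k) (hk_even : ∀ x, k (-x) = k x) :
    ∫⁻ x, ∫⁻ w, f x * k (x - w) * f w ∂μ ∂μ ≤
      2 * ∫⁻ x, f x * ∫⁻ w in {w | f w ≤ f x}, k (x - w) * f w ∂μ ∂μ := by
  set T : Set (E × E) := {z | f z.2 ≤ f z.1}
  have hT : MeasurableSet T := measurableSet_le (by fun_prop) (by fun_prop)
  set F : E × E → ℝ≥0∞ := T.indicator fun z => f z.1 * (k (z.1 - z.2) * f z.2) with hF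
  have hFm : Measurable F := Measurable.indicator (by fun_prop) hT
  have hFi : ∀ x, ∫⁻ w, F (x, w) ∂μ = f x * ∫⁻ w in {w | f w ≤ f x}, k (x - w) * f w ∂μ := by
    intro x
    have hS : MeasurableSet {w | f w ≤ f x} := measurableSet_le hf measurable_const
    rw [← lintegral_const_mul _ (by fun_prop), ← lintegral_indicator hS]
    rfl
  have hle : ∀ x w, f x * k (x - w) * f w ≤ F (x, w) + F (w, x) := by
    intro x w
    rcases le_total (f w) (f x) with h | h
    · have : F (x, w) = f x * (k (x - w) * f w) := Set.indicator_of_mem (show (x, w) ∈ T from h) _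
      rw [this, mul_assoc]
      exact le_self_add
    · have : F (w, x) = f w * (k (w - x) * f x) := Set.indicator_of_mem (show (w, x) ∈ T from h) _
      rw [this, ← hk_even (w - x), neg_sub, mul_comm (f x), mul_comm (_ * _) (f w)]
      exact le_add_self
  calc ∫⁻ x, ∫⁻ w, f x * k (x - w) * f w ∂μ ∂μ
      ≤ ∫⁻ x, ∫⁻ w, (F (x, w) + F (w, x)) ∂μ ∂μ :=
        lintegral_mono fun x => lintegral_mono fun w => hle x w
    _ = ∫⁻ x, ∫⁻ w, F (x, w) ∂μ ∂μ + ∫⁻ x, ∫⁻ w, F (w, x) ∂μ ∂μ := by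
        rw [← lintegral_add_left hFm.lintegral_prod_right']
        exact lintegral_congr fun x => lintegral_add_left (by fun_prop) _
    _ = 2 * ∫⁻ x, ∫⁻ w, F (x, w) ∂μ ∂μ := by
        rw [two_mul, lintegral_lintegral_swap (f := fun x w => F (w, x))]
        exact (hFm.comp measurable_swap).aemeasurable
    _ = _ := by simp_rw [hFi]

/-- Young's inequality for the bilinear form of an even integrable kernel on `L²`. -/
lemma lintegral_lintegral_kernel_le_lintegral_sq {f k : E → ℝ≥0∞} (hf : Measurable f)
    (hk : Measurable k) (hk_even : ∀ x, k (-x) = k x) :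
    ∫⁻ x, ∫⁻ w, f x * k (x - w) * f w ∂μ ∂μ ≤
      2 * ((∫⁻ y, k y ∂μ) * ∫⁻ x, f x ^ (2 : ℝ) ∂μ) := by
  refine (lintegral_lintegral_kernel_le_two_mul μ hf hk hk_even).trans ?_
  gcongr
  rw [← lintegral_const_mul _ (by fun_prop)]
  refine lintegral_mono fun x => ?_
  calc f x * ∫⁻ w in {w | f w ≤ f x}, k (x - w) * f w ∂μ
      ≤ f x * ∫⁻ w in {w | f w ≤ f x}, k (x - w) * f x ∂μ := by
        refine mul_le_mul' le_rfl (setLIntegral_mono (by fun_prop) fun w hw => ?_)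
        exact mul_le_mul' le_rfl hw
    _ ≤ f x * ∫⁻ w, k (x - w) * f x ∂μ :=
        mul_le_mul' le_rfl (setLIntegral_le_lintegral _ _)
    _ = (∫⁻ y, k y ∂μ) * f x ^ (2 : ℝ) := by
        rw [lintegral_mul_const _ (by fun_prop), lintegral_sub_left_eq_self, ENNReal.rpow_two]
        ring

lemma setLIntegral_enorm_rpow_mul_le {f : E → ℝ≥0∞} (hf : Measurable f) {p q : ℝ}
    (hpq : p.HolderConjugate q) (s : ℝ) (x : E) {R : ℝ} (hR : 0 < R) :
    ∫⁻ w in {w | f w ≤ f x}, ‖x - w‖ₑ ^ (-s) * f w ∂μ ≤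
      f x * (ENNReal.ofReal R ^ (finrank ℝ E - s) * ∫⁻ y in ball 0 1, ‖y‖ₑ ^ (-s) ∂μ) +
      (∫⁻ w, f w ^ p ∂μ) ^ (1 / p) * (ENNReal.ofReal R ^ (finrank ℝ E - s * q) *
        ∫⁻ y in (ball 0 1)ᶜ, ‖y‖ₑ ^ (-(s * q)) ∂μ) ^ (1 / q) := by
  have hb : MeasurableSet (ball (0 : E) R) := measurableSet_ball
  have hS : MeasurableSet {w | f w ≤ f x} := measurableSet_le hf measurable_const
  set k : E → ℝ≥0∞ := fun y => ‖y‖ₑ ^ (-s)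
  have hk : Measurable k := by fun_prop
  have hk₁ : Measurable ((ball 0 R).indicator k) := hk.indicator hb
  have hk₂ : Measurable ((ball 0 R)ᶜ.indicator k) := hk.indicator hb.compl
  rw [← setLIntegral_ball_enorm_rpow μ hR, ← setLIntegral_compl_ball_enorm_rpow μ hR,
    ← lintegral_indicator hS]
  calc ∫⁻ w, {w | f w ≤ f x}.indicator (fun w => k (x - w) * f w) w ∂μ
      ≤ ∫⁻ w, (f x * (ball 0 R).indicator k (x - w) +
          f w * (ball 0 R)ᶜ.indicator k (x - w)) ∂μ := by
        refine lintegral_mono fun w => Set.indicator_le' (g := fun w =>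
          f x * (ball 0 R).indicator k (x - w) + f w * (ball 0 R)ᶜ.indicator k (x - w))
          (fun w hw => ?_) (fun _ _ => zero_le) w
        have hw : f w ≤ f x := hw
        by_cases h : x - w ∈ ball (0 : E) R
        · rw [Set.indicator_of_mem h, mul_comm]
          exact (mul_le_mul' hw le_rfl).trans le_self_add
        · rw [Set.indicator_of_mem (Set.mem_compl h), mul_comm]
          exact le_add_self
    _ = f x * ∫⁻ w, (ball 0 R).indicator k (x - w) ∂μ +
          ∫⁻ w, f w * (ball 0 R)ᶜ.indicator k (x - w) ∂μ := by
        rw [lintegral_add_left (by fun_prop), lintegral_const_mul _ (by fun_prop)]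
    _ ≤ f x * ∫⁻ w, (ball 0 R).indicator k (x - w) ∂μ +
          (∫⁻ w, f w ^ p ∂μ) ^ (1 / p) *
            (∫⁻ w, ((ball 0 R)ᶜ.indicator k (x - w)) ^ q ∂μ) ^ (1 / q) := by
        gcongr
        exact ENNReal.lintegral_mul_le_Lp_mul_Lq μ hpq hf.aemeasurable
          (hk₂.comp (measurable_const.sub measurable_id)).aemeasurable
    _ = _ := by
        rw [lintegral_sub_left_eq_self ((ball 0 R).indicator k) x,
          lintegral_sub_left_eq_self (fun y => ((ball 0 R)ᶜ.indicator k y) ^ q) x,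
          lintegral_indicator hb, ← lintegral_indicator hb.compl]
        congr 4
        ext y
        by_cases hy : y ∈ (ball (0 : E) R)ᶜ
        · simp only [Set.indicator_of_mem hy, k, ← ENNReal.rpow_mul, neg_mul]
        · simp only [Set.indicator_of_notMem hy, ENNReal.zero_rpow_of_pos hpq.symm.pos]

/-- The **Hardy–Littlewood–Sobolev inequality** on the diagonal, for the kernel
`‖x - w‖ ^ (-2d/q)` with `q > 2` on a space of dimension `d`. -/
theorem exists_lintegral_lintegral_enorm_rpow_le (hd : 1 ≤ finrank ℝ E) {p q : ℝ} (hq : 2 < q)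
    (hpq : p.HolderConjugate q) :
    ∃ C : ℝ≥0∞, C ≠ ⊤ ∧ ∀ f : E → ℝ≥0∞, Measurable f → (∀ x, f x ≠ ⊤) →
      ∫⁻ x, ∫⁻ w, f x * ‖x - w‖ₑ ^ (-(2 * finrank ℝ E / q)) * f w ∂μ ∂μ ≤
        C * (∫⁻ x, f x ^ p ∂μ) ^ (2 / p) := by
  set d : ℝ := (finrank ℝ E : ℝ) with hd_def
  have hd0 : 0 < d := by rw [hd_def]; exact_mod_cast hd
  have hq0 : 0 < q := by linarith
  have hp0 : 0 < p := hpq.pos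
  have hp : p = q / (q - 1) := hpq.symm.conjugate_eq
  have hq1 : q - 1 ≠ 0 := by linarith
  set s : ℝ := 2 * d / q with hs
  have hsq : s * q = 2 * d := by rw [hs]; field_simp
  have hsd : s < d := by rw [hs, div_lt_iff₀ hq0]; nlinarith
  set B := ∫⁻ y in ball 0 1, ‖y‖ₑ ^ (-s) ∂μ
  set D := ∫⁻ y in (ball 0 1)ᶜ, ‖y‖ₑ ^ (-(s * q)) ∂μ
  have hB : B ≠ ⊤ := setLIntegral_ball_enorm_rpow_ne_top μ hd hsd
  have hD : D ≠ ⊤ := setLIntegral_compl_ball_enorm_rpow_ne_top μ (by rw [hsq]; linarith)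
  have hBD : B + D ^ (1 / q) + 1 ≠ ⊤ := by
    simp [hB, hD, ENNReal.rpow_eq_top_iff, hq0.le]
  refine ⟨2 * (B + D ^ (1 / q) + 1), ENNReal.mul_ne_top (by simp) hBD, fun f hf hft => ?_⟩
  set A := ∫⁻ x, f x ^ p ∂μ with hA
  rcases eq_or_ne A ⊤ with hAt | hAt
  · rw [hAt, ENNReal.top_rpow_of_pos (by positivity), ENNReal.mul_top (by simp)]
    exact le_top
  rcases eq_or_ne A 0 with hA0 | hA0
  · have hf0 : f =ᵐ[μ] 0 := by
      filter_upwards [(lintegral_eq_zero_iff (by fun_prop)).1 hA0] with x hx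
      simpa [hp0, hp0.not_gt] using hx
    have : ∫⁻ x, ∫⁻ w, f x * ‖x - w‖ₑ ^ (-s) * f w ∂μ ∂μ = 0 := by
      rw [lintegral_congr_ae (g := 0) (by filter_upwards [hf0] with x hx; simp [hx])]
      simp
    rw [this]
    exact zero_le
  have hinner : ∀ x, f x * ∫⁻ w in {w | f w ≤ f x}, ‖x - w‖ₑ ^ (-s) * f w ∂μ ≤
      (B + D ^ (1 / q)) * A ^ (1 - 2 / q) * f x ^ p := by
    intro x
    rcases eq_or_ne (f x) 0 with hx0 | hx0
    · simp [hx0]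
    set t := f x
    have ht := hft x
    set ρ : ℝ≥0∞ := (A * t ^ (-p)) ^ (1 / d) with hρ
    have htp : t ^ (-p) ≠ ⊤ := ENNReal.rpow_ne_top_of_ne_zero hx0 ht
    have hρe : ∀ e : ℝ, ρ ^ e = A ^ (e / d) * t ^ (-(p * e / d)) := by
      intro e
      rw [hρ, ← ENNReal.rpow_mul, ENNReal.mul_rpow_of_ne_top hAt htp, ← ENNReal.rpow_mul]
      congr 2 <;> ring
    have hbase0 : A * t ^ (-p) ≠ 0 :=
      mul_ne_zero hA0 (ENNReal.rpow_pos (pos_iff_ne_zero.2 hx0) ht |>.ne')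
    have hbaset : A * t ^ (-p) ≠ ⊤ := ENNReal.mul_ne_top hAt htp
    have hρt : ρ ≠ ⊤ := ENNReal.rpow_ne_top_of_nonneg (by positivity) hbaset
    have hρ0 : ρ ≠ 0 := (ENNReal.rpow_pos (pos_iff_ne_zero.2 hbase0) hbaset).ne'
    have hmain := setLIntegral_enorm_rpow_mul_le μ hf hpq s x (ENNReal.toReal_pos hρ0 hρt)
    rw [ENNReal.ofReal_toReal hρt] at hmain
    have hnear : t * (t * (ρ ^ (d - s) * B)) = B * A ^ (1 - 2 / q) * t ^ p := by
      have h1 : (d - s) / d = 1 - 2 / q := by rw [hs]; field_simp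
      have h2 : t * t * t ^ (-(p * (d - s) / d)) = t ^ p := by
        nth_rewrite 1 2 [← ENNReal.rpow_one t]
        rw [← ENNReal.rpow_add _ _ hx0 ht, ← ENNReal.rpow_add _ _ hx0 ht]
        congr 1
        rw [hp, hs]
        field_simp
        ring
      rw [hρe, h1, ← h2]
      ring
    have hfar : t * (A ^ (1 / p) * (ρ ^ (d - s * q) * D) ^ (1 / q)) =
        D ^ (1 / q) * A ^ (1 - 2 / q) * t ^ p := by
      have h1 : A ^ (1 / p) * A ^ ((d - s * q) * (1 / q) / d) = A ^ (1 - 2 / q) := by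
        rw [← ENNReal.rpow_add _ _ hA0 hAt]
        congr 1
        rw [hp, hsq]
        field_simp
        ring
      have h2 : t * t ^ (-(p * ((d - s * q) * (1 / q)) / d)) = t ^ p := by
        nth_rewrite 1 [← ENNReal.rpow_one t]
        rw [← ENNReal.rpow_add _ _ hx0 ht]
        congr 1
        rw [hp, hsq]
        field_simp
        ring
      rw [ENNReal.mul_rpow_of_nonneg _ _ (by positivity), ← ENNReal.rpow_mul, hρe, ← h1, ← h2]
      ring
    calc t * ∫⁻ w in {w | f w ≤ t}, ‖x - w‖ₑ ^ (-s) * f w ∂μ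
        ≤ t * (t * (ρ ^ (d - s) * B) + A ^ (1 / p) * (ρ ^ (d - s * q) * D) ^ (1 / q)) := by
          gcongr
      _ = (B + D ^ (1 / q)) * A ^ (1 - 2 / q) * t ^ p := by
          rw [mul_add, hnear, hfar]
          ring
  have hexp : A ^ (1 - 2 / q) * A = A ^ (2 / p) := by
    nth_rewrite 2 [← ENNReal.rpow_one A]
    rw [← ENNReal.rpow_add _ _ hA0 hAt]
    congr 1
    rw [hp]
    field_simp
    ring
  calc ∫⁻ x, ∫⁻ w, f x * ‖x - w‖ₑ ^ (-s) * f w ∂μ ∂μ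
      ≤ 2 * ∫⁻ x, f x * ∫⁻ w in {w | f w ≤ f x}, ‖x - w‖ₑ ^ (-s) * f w ∂μ ∂μ :=
        lintegral_lintegral_kernel_le_two_mul μ hf (k := fun y => ‖y‖ₑ ^ (-s)) (by fun_prop)
          (fun y => by rw [enorm_neg])
    _ ≤ 2 * ∫⁻ x, (B + D ^ (1 / q)) * A ^ (1 - 2 / q) * f x ^ p ∂μ :=
        mul_le_mul' le_rfl (lintegral_mono hinner)
    _ = 2 * (B + D ^ (1 / q)) * A ^ (2 / p) := by
        rw [lintegral_const_mul _ (by fun_prop), ← hA, ← hexp]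
        ring
    _ ≤ _ := mul_le_mul' (mul_le_mul' le_rfl le_self_add) le_rfl

end Convolution

/-- **Gagliardo–Nirenberg inequality for Bessel kernels, bilinear form.**
For `0 < α_k < n`, `0 < mn − α < n`, `2 ≤ q ≤ 2n/(mn−α)`, `p = q/(q−1)`,
there is a finite constant `C` with
`∫∫ h(x) Π_k G_{α_k}(x−w) h(w) dx dw ≤ C (∫ h^p)^{2/p}` for all nonnegative `h`. -/
theorem stmt14 (m n : ℕ) (hm : 1 ≤ m) (hn : 1 ≤ n)
    (α : Fin m → ℝ) (hα : ∀ k, 0 < α k ∧ α k < n)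
    (hlow : 0 < (m : ℝ) * n - ∑ k, α k) (hhigh : (m : ℝ) * n - (∑ k, α k) < n)
    (q p : ℝ) (hq2 : 2 ≤ q) (hq : q ≤ 2 * n / ((m : ℝ) * n - ∑ k, α k))
    (hp : p = q / (q - 1)) :
    ∃ C : ℝ≥0∞, C ≠ ⊤ ∧
      ∀ h : EuclideanSpace ℝ (Fin n) → ℝ, Measurable h → (∀ x, 0 ≤ h x) →
        (∫⁻ x : EuclideanSpace ℝ (Fin n), ∫⁻ w : EuclideanSpace ℝ (Fin n),
            ENNReal.ofReal (h x) * (∏ k, ENNReal.ofReal (besselG n (α k) (x - w))) *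
              ENNReal.ofReal (h w)) ≤
          C * (∫⁻ x, ENNReal.ofReal (h x) ^ p) ^ (2 / p) := by
  have hdim : Module.finrank ℝ (EuclideanSpace ℝ (Fin n)) = n := finrank_euclideanSpace_fin
  have hd : 1 ≤ Module.finrank ℝ (EuclideanSpace ℝ (Fin n)) := by rwa [hdim]
  have hn0 : (0 : ℝ) < n := by exact_mod_cast hn
  rcases hq2.eq_or_lt with rfl | hq2
  · have hp2 : p = 2 := by rw [hp]; norm_num
    obtain ⟨C₁, hC₁, hle₁⟩ := exists_prod_besselG_le_mul_enorm_rpow hα hlow le_rfl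
    obtain ⟨C₂, hC₂, hle₂⟩ := exists_prod_besselG_le_mul_enorm_rpow hα hlow
      (s := 2 * n) (by linarith)
    set l := (m : ℝ) * n - ∑ k, α k
    set k : EuclideanSpace ℝ (Fin n) → ℝ≥0∞ := fun y =>
      min (C₁ * ‖y‖ₑ ^ (-l)) (C₂ * ‖y‖ₑ ^ (-(2 * n : ℝ))) with hk
    have hkm : Measurable k := by fun_prop
    have hk_top : ∫⁻ y, k y ≠ ⊤ := by
      rw [← lintegral_add_compl k (measurableSet_ball (x := 0) (ε := 1))]
      refine ENNReal.add_ne_top.2 ⟨ne_top_of_le_ne_top (ENNReal.mul_ne_top hC₁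
        (setLIntegral_ball_enorm_rpow_ne_top volume hd (s := l) (by rwa [hdim]))) ?_,
        ne_top_of_le_ne_top (ENNReal.mul_ne_top hC₂
        (setLIntegral_compl_ball_enorm_rpow_ne_top volume (s := 2 * n)
          (by rw [hdim]; linarith))) ?_⟩
      · rw [← lintegral_const_mul _ (by fun_prop)]
        exact lintegral_mono fun y => min_le_left _ _
      · rw [← lintegral_const_mul _ (by fun_prop)]
        exact lintegral_mono fun y => min_le_right _ _
    refine ⟨2 * ∫⁻ y, k y, ENNReal.mul_ne_top (by simp) hk_top, fun h hh _ => ?_⟩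
    rw [hp2, div_self two_ne_zero, ENNReal.rpow_one, mul_assoc]
    refine le_trans ?_ (lintegral_lintegral_kernel_le_lintegral_sq volume hh.ennreal_ofReal hkm
      fun y => by simp only [hk, enorm_neg])
    gcongr with x w
    exact le_min (hle₁ _) (hle₂ _)
  · have hpq : p.HolderConjugate q :=
      (Real.HolderConjugate.symm ((Real.holderConjugate_iff_eq_conjExponent (by linarith)).2 hp))
    have hls : (m : ℝ) * n - ∑ k, α k ≤ 2 * n / q := by
      rw [le_div_iff₀ hlow] at hq
      rw [le_div_iff₀ (by linarith)]
      linarith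
    obtain ⟨C₁, hC₁, hle₁⟩ := exists_prod_besselG_le_mul_enorm_rpow hα hlow hls
    obtain ⟨C₂, hC₂, hle₂⟩ := exists_lintegral_lintegral_enorm_rpow_le
      (volume : Measure (EuclideanSpace ℝ (Fin n))) hd hq2 hpq
    rw [hdim] at hle₂
    refine ⟨C₁ * C₂, ENNReal.mul_ne_top hC₁ hC₂, fun h hh _ => ?_⟩
    calc ∫⁻ x, ∫⁻ w, ENNReal.ofReal (h x) * (∏ k, ENNReal.ofReal (besselG n (α k) (x - w))) *
            ENNReal.ofReal (h w)
        ≤ ∫⁻ x, ∫⁻ w, C₁ * (ENNReal.ofReal (h x) * ‖x - w‖ₑ ^ (-(2 * n / q)) *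
            ENNReal.ofReal (h w)) := by
          refine lintegral_mono fun x => lintegral_mono fun w => ?_
          calc _ ≤ ENNReal.ofReal (h x) * (C₁ * ‖x - w‖ₑ ^ (-(2 * n / q))) *
                ENNReal.ofReal (h w) := by
                gcongr
                exact hle₁ _
            _ = _ := by ring
      _ = C₁ * ∫⁻ x, ∫⁻ w, ENNReal.ofReal (h x) * ‖x - w‖ₑ ^ (-(2 * n / q)) *
            ENNReal.ofReal (h w) := by
          simp_rw [lintegral_const_mul' _ _ hC₁]
      _ ≤ _ := by
          rw [mul_assoc]
          gcongr
          exact hle₂ _ hh.ennreal_ofReal fun x => ENNReal.ofReal_ne_top
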